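/- There exist real numbers γ_{m,i} for 1 ≤ m ≤ 4, 0 ≤ i ≤ m−1, with Σ_{i=0}^{m−1} γ_{m,i} = 1 for each m = 1, 2, 3, 4, such that: (a) the coefficients β_{j,m} defined by the stated recursion satisfy the consistency equations β_{2,4}/β_{1,4}² = 1/2 and β_{3,4}/β_{1,4}² = 1 (with β_{1,4} ≠ 0); and (b) the quantities γ̃ and S̃ defined by the stated downward recursion satisfy S̃_{m,m} > 0 for m = 1, 2, 3, 4. In particular one may take γ_{1,0} = 1, γ_{2,0} = −1/4, γ_{2,1} = 5/4, γ_{3,0} = 5/6, γ_{3,1} = −2/3, γ_{3,2} = 5/6, γ_{4,1} = 1/2, with suitable algebraic values of γ_{4,0}, γ_{4,2}, γ_{4,3} summing with γ_{4,1} to 1. -/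

import Mathlib

/-- The recursion defining the consistency coefficients `β_{j,m}`, `j = 1,…,5`,
`m = 0,…,M`, of the `M`-stage threshold dynamics scheme with weights `γ`. -/
def betaRec (M : ℕ) (γ β : ℕ → ℕ → ℝ) : Prop :=
  (∀ j, β j 0 = 0) ∧
  ∀ m, 1 ≤ m → m ≤ M →
    β 1 m = 1 + ∑ i ∈ Finset.range m, γ m i * β 1 i ∧
    β 2 m = 1 / 2 + (∑ i ∈ Finset.range m, γ m i * β 2 i)
      + ∑ i ∈ Finset.range m, γ m i * β 4 i ∧
    β 3 m = 2 / 3 + (1 / 6) * (∑ i ∈ Finset.range m, γ m i * β 1 i) ^ 3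
      - (1 / 4) * (∑ i ∈ Finset.range m, γ m i * β 1 i)
          * (∑ i ∈ Finset.range m, γ m i * (β 1 i) ^ 2)
      + (1 / 12) * (∑ i ∈ Finset.range m, γ m i * (β 1 i) ^ 3)
      + (∑ i ∈ Finset.range m, γ m i * β 3 i)
      + ∑ i ∈ Finset.range m, γ m i * β 5 i ∧
    β 4 m = 1 + ∑ i ∈ Finset.range m, γ m i * β 4 i ∧
    β 5 m = 2 + ∑ i ∈ Finset.range m, γ m i * β 5 i

/-- The downward recursion defining the stability coefficients `γ̃_{m,i}` and the
partial sums `S̃_{j,m}` from the weights `γ` of an `M`-stage scheme. -/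
def tildeRec (M : ℕ) (γ γt St : ℕ → ℕ → ℝ) : Prop :=
  (∀ i < M, γt M i = γ M i) ∧
  (∀ m, 1 ≤ m → m < M → ∀ i < m,
    γt m i = γ m i - ∑ j ∈ Finset.Icc (m + 1) M, γt j i * St j m / St j j) ∧
  (∀ j m : ℕ, St j m = ∑ i ∈ Finset.range m, γt j i)

set_option maxHeartbeats 4000000

/-- A root of the consistency cubic, localised in a small interval. -/
lemma cubic_root : ∃ s : ℝ, 3.194769 ≤ s ∧ s ≤ 3.19477 ∧
    -543761/1018368 + 361051/1018368 * s - 212851/339456 * s^2 + 7549/42432 * s^3 = 0 := by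
  have hc : ContinuousOn (fun s : ℝ => -543761/1018368 + 361051/1018368 * s
      - 212851/339456 * s^2 + 7549/42432 * s^3) (Set.Icc 3.194769 3.19477) := by fun_prop
  have h := intermediate_value_Icc (by norm_num : (3.194769 : ℝ) ≤ 3.19477) hc
  obtain ⟨s, hs, h0⟩ := h (show (0:ℝ) ∈ _ by constructor <;> norm_num)
  exact ⟨s, hs.1, hs.2, h0⟩

/-- The weights. -/
noncomputable def gam (a x y : ℝ) : ℕ → ℕ → ℝ
  | 1, 0 => 1
  | 2, 0 => -(1/4)
  | 2, 1 => 5/4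
  | 3, 0 => 5/6
  | 3, 1 => -(2/3)
  | 3, 2 => 5/6
  | 4, 0 => a
  | 4, 1 => 1/2
  | 4, 2 => x
  | 4, 3 => y
  | _, _ => 0

/-- The consistency coefficients, with `s = β_{1,4} - 1`. -/
noncomputable def bet (s : ℝ) : ℕ → ℕ → ℝ
  | 1, 1 => 1
  | 1, 2 => 9/4
  | 1, 3 => 53/24
  | 1, 4 => 1 + s
  | 2, 1 => 1/2
  | 2, 2 => 19/8
  | 2, 3 => 161/48
  | 2, 4 => (1 + s)^2 / 2
  | 3, 1 => 2/3
  | 3, 2 => 517/128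
  | 3, 3 => 247225/41472
  | 3, 4 => (1 + s)^2
  | 4, 1 => 1
  | 4, 2 => 9/4
  | 4, 3 => 53/24
  | 4, 4 => 1 + s
  | 5, 1 => 2
  | 5, 2 => 9/2
  | 5, 3 => 53/12
  | 5, 4 => 2 + 2 * s
  | _, _ => 0

/-- The modified weights. -/
noncomputable def gamt (a x y t30 t31 t32 t20 t21 t10 : ℝ) : ℕ → ℕ → ℝ
  | 1, 0 => t10
  | 2, 0 => t20
  | 2, 1 => t21
  | 3, 0 => t30
  | 3, 1 => t31
  | 3, 2 => t32
  | 4, 0 => a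
  | 4, 1 => 1/2
  | 4, 2 => x
  | 4, 3 => y
  | _, _ => 0

/-- The four product inequalities for two variables in intervals. -/
lemma box {l u m n a b : ℝ} (h1 : l ≤ a) (h2 : a ≤ u) (h3 : m ≤ b) (h4 : b ≤ n) :
    0 ≤ (a - l) * (b - m) ∧ 0 ≤ (a - l) * (n - b) ∧
    0 ≤ (u - a) * (b - m) ∧ 0 ≤ (u - a) * (n - b) :=
  ⟨mul_nonneg (by linarith) (by linarith), mul_nonneg (by linarith) (by linarith),
   mul_nonneg (by linarith) (by linarith), mul_nonneg (by linarith) (by linarith)⟩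

lemma betaRec_bet (s x y : ℝ) (hx : x = (-108 + 322 * s - 106 * s^2)/221)
    (hy : y = (60 - 228 * s + 108 * s^2)/221)
    (h0 : -543761/1018368 + 361051/1018368 * s - 212851/339456 * s^2 + 7549/42432 * s^3 = 0) :
    betaRec 4 (gam (1/2 - x - y) x y) (bet s) := by
  have h1 : 1/2 + x * (9/4) + y * (53/24) = s := by rw [hx, hy]; ring
  refine ⟨fun j => ?_, fun m hm1 hm4 => ?_⟩
  · unfold bet; split <;> simp_all
  · interval_cases m
    · norm_num [Finset.sum_range_succ, gam, bet]
    · norm_num [Finset.sum_range_succ, gam, bet]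
    · norm_num [Finset.sum_range_succ, gam, bet]
    · simp only [Finset.sum_range_succ, Finset.sum_range_zero, gam, bet]
      refine ⟨by linarith, by rw [hx, hy]; ring, ?_, by linarith, by linarith⟩
      have e1 : 0 + (1/2 - x - y) * 0 + 1/2 * 1 + x * (9/4) + y * (53/24) = s := by linarith
      rw [e1, hx, hy]
      linear_combination -h0

lemma tildeRec_gamt (x y t30 t31 t32 t20 t21 t10 S33 S22 : ℝ)
    (h30 : t30 = 5/6 - (1/2 - x - y) * (1 - y))
    (h31 : t31 = -(2/3) - 1/2 * (1 - y))
    (h32 : t32 = 5/6 - x * (1 - y))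
    (hS33 : t30 + t31 + t32 = S33)
    (h20 : t20 = -(1/4) - (1/2 - x - y) * (1 - x - y) - t30 * (t30 + t31) / S33)
    (h21 : t21 = 5/4 - 1/2 * (1 - x - y) - t31 * (t30 + t31) / S33)
    (hS22 : t20 + t21 = S22)
    (h10 : t10 = 1 - (1/2 - x - y)^2 - t30 * t30 / S33 - t20 * t20 / S22) :
    tildeRec 4 (gam (1/2 - x - y) x y)
      (gamt (1/2 - x - y) x y t30 t31 t32 t20 t21 t10)
      (fun j m => ∑ i ∈ Finset.range m,
        gamt (1/2 - x - y) x y t30 t31 t32 t20 t21 t10 j i) := by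
  have e4 : 1/2 - x - y + 1/2 + x + y = 1 := by ring
  refine ⟨fun i hi => ?_, fun m hm1 hm4 i hi => ?_, fun j m => rfl⟩
  · interval_cases i <;> rfl
  · have i1 : Finset.Icc (1+1) 4 = {2, 3, 4} := by decide
    have i2 : Finset.Icc (2+1) 4 = {3, 4} := by decide
    have i3 : Finset.Icc (3+1) 4 = {4} := by decide
    interval_cases m
    · interval_cases i
      rw [i1, Finset.sum_insert (by decide), Finset.sum_insert (by decide), Finset.sum_singleton]
      simp only [Finset.sum_range_succ, Finset.sum_range_zero, gam, gamt, zero_add, hS33, hS22, e4]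
      rw [h10]; ring
    · rw [i2, Finset.sum_insert (by decide), Finset.sum_singleton]
      interval_cases i
      · simp only [Finset.sum_range_succ, Finset.sum_range_zero, gam, gamt, zero_add, hS33, e4]
        rw [h20]; ring
      · simp only [Finset.sum_range_succ, Finset.sum_range_zero, gam, gamt, zero_add, hS33, e4]
        rw [h21]; ring
    · rw [i3, Finset.sum_singleton]
      interval_cases i
      · simp only [Finset.sum_range_succ, Finset.sum_range_zero, gam, gamt, zero_add, e4]
        rw [h30]; ring
      · simp only [Finset.sum_range_succ, Finset.sum_range_zero, gam, gamt, zero_add, e4]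
        rw [h31]; ring
      · simp only [Finset.sum_range_succ, Finset.sum_range_zero, gam, gamt, zero_add, e4]
        rw [h32]; ring

/-- There exists a four-stage threshold dynamics scheme that is simultaneously
second order consistent (`β_{2,4}/β_{1,4}² = 1/2`, `β_{3,4}/β_{1,4}² = 1`) and
unconditionally energy stable (`S̃_{m,m} > 0` for `m = 1,2,3,4`); in particular one
may take `γ_{1,0} = 1`, `γ_{2,0} = −1/4`, `γ_{2,1} = 5/4`, `γ_{3,0} = 5/6`,
`γ_{3,1} = −2/3`, `γ_{3,2} = 5/6`, `γ_{4,1} = 1/2`. -/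
theorem exists_second_order_stable_four_stage :
    ∃ γ : ℕ → ℕ → ℝ,
      (∀ m, 1 ≤ m → m ≤ 4 → ∑ i ∈ Finset.range m, γ m i = 1) ∧
      γ 1 0 = 1 ∧ γ 2 0 = -(1 / 4) ∧ γ 2 1 = 5 / 4 ∧
      γ 3 0 = 5 / 6 ∧ γ 3 1 = -(2 / 3) ∧ γ 3 2 = 5 / 6 ∧ γ 4 1 = 1 / 2 ∧
      ∃ β : ℕ → ℕ → ℝ, betaRec 4 γ β ∧ β 1 4 ≠ 0 ∧
        β 2 4 / (β 1 4) ^ 2 = 1 / 2 ∧ β 3 4 / (β 1 4) ^ 2 = 1 ∧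
        ∃ γt St : ℕ → ℕ → ℝ, tildeRec 4 γ γt St ∧
          ∀ m, 1 ≤ m → m ≤ 4 → 0 < St m m := by
  obtain ⟨s, hs1, hs2, h0⟩ := cubic_root
  obtain ⟨x, hx⟩ : ∃ x, x = (-108 + 322 * s - 106 * s^2)/221 := ⟨_, rfl⟩
  obtain ⟨y, hy⟩ : ∃ y, y = (60 - 228 * s + 108 * s^2)/221 := ⟨_, rfl⟩
  obtain ⟨t30, h30⟩ : ∃ t, t = 5/6 - (1/2 - x - y) * (1 - y) := ⟨_, rfl⟩
  obtain ⟨t31, h31⟩ : ∃ t, t = -(2/3) - 1/2 * (1 - y) := ⟨_, rfl⟩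
  obtain ⟨t32, h32⟩ : ∃ t, t = 5/6 - x * (1 - y) := ⟨_, rfl⟩
  obtain ⟨S33, hS33⟩ : ∃ t, t30 + t31 + t32 = t := ⟨_, rfl⟩
  obtain ⟨t20, h20⟩ : ∃ t, t = -(1/4) - (1/2 - x - y) * (1 - x - y)
    - t30 * (t30 + t31) / S33 := ⟨_, rfl⟩
  obtain ⟨t21, h21⟩ : ∃ t, t = 5/4 - 1/2 * (1 - x - y) - t31 * (t30 + t31) / S33 := ⟨_, rfl⟩
  obtain ⟨S22, hS22⟩ : ∃ t, t20 + t21 = t := ⟨_, rfl⟩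
  obtain ⟨t10, h10⟩ : ∃ t, t = 1 - (1/2 - x - y)^2 - t30 * t30 / S33
    - t20 * t20 / S22 := ⟨_, rfl⟩
  have hss1 : 10.206548 ≤ s^2 := by
    obtain ⟨b01, b02, b03, b04⟩ := box hs1 hs2 hs1 hs2
    linarith
  have hss2 : s^2 ≤ 10.206556 := by
    obtain ⟨b01, b02, b03, b04⟩ := box hs1 hs2 hs1 hs2
    linarith
  have hy1 : 1.96334 ≤ y := by rw [hy]; linarith
  have hy2 : y ≤ 1.96336 := by rw [hy]; linarith
  obtain ⟨a, ha⟩ : ∃ a, a = 1/2 - x - y := ⟨_, rfl⟩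
  have ha1 : -0.73404 ≤ a := by rw [ha, hx, hy]; linarith
  have ha2 : a ≤ -0.73403 := by rw [ha, hx, hy]; linarith
  have eS33 : S33 = 1 - (1 - y)^2 := by rw [← hS33, h30, h31, h32]; ring
  have hS1 : 0.07193 ≤ S33 := by
    obtain ⟨b01, b02, b03, b04⟩ := box hy1 hy2 hy1 hy2
    rw [eS33]
    linarith
  have hS2 : S33 ≤ 0.07198 := by
    obtain ⟨b01, b02, b03, b04⟩ := box hy1 hy2 hy1 hy2
    rw [eS33]
    linarith
  have hSpos : 0 < S33 := by linarith
  rw [← ha] at h30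
  have ht1 : 0.12617 ≤ t30 := by
    obtain ⟨b01, b02, b03, b04⟩ := box ha1 ha2 hy1 hy2
    rw [h30]
    linarith
  have ht2 : t30 ≤ 0.12623 := by
    obtain ⟨b01, b02, b03, b04⟩ := box ha1 ha2 hy1 hy2
    rw [h30]
    linarith
  obtain ⟨u, hu⟩ : ∃ u, u = t30 + t31 := ⟨_, rfl⟩
  have hu1 : -0.05883 ≤ u := by rw [hu, h31]; linarith
  have hu2 : u ≤ -0.05875 := by rw [hu, h31]; linarith
  obtain ⟨q, hq⟩ : ∃ q, q = u / S33 := ⟨_, rfl⟩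
  have hq1 : -0.819 ≤ q := by rw [hq, le_div_iff₀ hSpos]; linarith
  have hq2 : q ≤ -0.815 := by rw [hq, div_le_iff₀ hSpos]; linarith
  obtain ⟨p, hp⟩ : ∃ p, p = t30 / S33 := ⟨_, rfl⟩
  have hp1 : 1.75 ≤ p := by rw [hp, le_div_iff₀ hSpos]; linarith
  have hp2 : p ≤ 1.758 := by rw [hp, div_le_iff₀ hSpos]; linarith
  have e20 : t20 = -(1/4) - a * (a + 1/2) - t30 * q := by
    rw [h20, hq, hu, ha]; ring
  have eS22 : S22 = 1 - (a + 1/2)^2 - u * q := by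
    rw [← hS22, h20, h21, hq, hu, ha]; ring
  have ht201 : -0.32 ≤ t20 := by
    obtain ⟨b01, b02, b03, b04⟩ := box ha1 ha2 ha1 ha2
    obtain ⟨b11, b12, b13, b14⟩ := box ht1 ht2 hq1 hq2
    rw [e20]
    linarith
  have ht202 : t20 ≤ -0.317 := by
    obtain ⟨b01, b02, b03, b04⟩ := box ha1 ha2 ha1 ha2
    obtain ⟨b11, b12, b13, b14⟩ := box ht1 ht2 hq1 hq2
    rw [e20]
    linarith
  have hS22l : 0.89 ≤ S22 := by
    obtain ⟨b01, b02, b03, b04⟩ := box ha1 ha2 ha1 ha2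
    obtain ⟨b11, b12, b13, b14⟩ := box hu1 hu2 hq1 hq2
    rw [eS22]
    linarith
  have hS22pos : 0 < S22 := by linarith
  have hr : t20 * t20 / S22 ≤ 0.12 := by
    obtain ⟨b01, b02, b03, b04⟩ := box ht201 ht202 ht201 ht202
    rw [div_le_iff₀ hS22pos]
    linarith
  have e10 : t10 = 1 - a^2 - t30 * p - t20 * t20 / S22 := by
    rw [h10, hp, ha]; ring
  have ht10 : 0 < t10 := by
    obtain ⟨b01, b02, b03, b04⟩ := box ha1 ha2 ha1 ha2
    obtain ⟨b11, b12, b13, b14⟩ := box ht1 ht2 hp1 hp2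
    rw [e10]
    linarith
  rw [ha] at h30
  refine ⟨gam (1/2 - x - y) x y, ?_, rfl, rfl, rfl, rfl, rfl, rfl, rfl, bet s,
    betaRec_bet s x y hx hy h0, ?_, ?_, ?_, _, _,
    tildeRec_gamt x y t30 t31 t32 t20 t21 t10 S33 S22 h30 h31 h32 hS33 h20 h21 hS22 h10, ?_⟩
  · intro m h1 h4
    interval_cases m <;> simp only [Finset.sum_range_succ, Finset.sum_range_zero, gam] <;> ring
  · simp only [bet]; exact ne_of_gt (by linarith)
  · have : (1 + s) ≠ 0 := ne_of_gt (by linarith)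
    simp only [bet]; field_simp
  · have : (1 + s) ≠ 0 := ne_of_gt (by linarith)
    simp only [bet]; field_simp
  · intro m h1 h4
    interval_cases m <;> simp only [Finset.sum_range_succ, Finset.sum_range_zero, gamt] <;> linarith
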